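/- arXiv:2010.11733 — 3 statements merged into one kernel-verified Lean document; each statement's English description precedes it below -/
import Mathlib

section
/- With N and the sequential policy π' as defined, for every subset ε of {1,…,m} the sequential policy defines a probability distribution over the remaining choices; that is, π'(† | ε) + Σ_{j ∉ ε} π'(j | ε) = 1. -/
/-- `N π ε = Σ_{A ⊇ ε} π(A) · |ε|! · (|A| − |ε|)! / |A|!`, the sum over all
subsets `A` of `Fin m` containing `ε`. -/
noncomputable def N {m : ℕ} (π : Finset (Fin m) → ℝ) (ε : Finset (Fin m)) : ℝ :=
  ∑ A ∈ Finset.univ.filter (fun A => ε ⊆ A),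
    π A * (Nat.factorial ε.card : ℝ) * (Nat.factorial (A.card - ε.card) : ℝ) /
      (Nat.factorial A.card : ℝ)

/-- The sequential policy `π'` induced by `π`: given the already-chosen set `ε`,
`some j` is chosen with probability `(1/N(ε)) · Σ_{A ⊇ ε ∪ {j}} π(A) · |ε|! · (|A|−|ε|−1)! / |A|!`
(for `j ∉ ε`), and the termination symbol `†` (here `none`) with probability `π(ε)/N(ε)`. -/
noncomputable def seqPolicy {m : ℕ} (π : Finset (Fin m) → ℝ) (ε : Finset (Fin m)) :
    Option (Fin m) → ℝ
  | none => π ε / N π ε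
  | some j =>
      (1 / N π ε) *
        ∑ A ∈ Finset.univ.filter (fun A => insert j ε ⊆ A),
          π A * (Nat.factorial ε.card : ℝ) * (Nat.factorial (A.card - ε.card - 1) : ℝ) /
            (Nat.factorial A.card : ℝ)

theorem sum_compl_sum_insert_subset {α M : Type*} [Fintype α] [DecidableEq α] [AddCommMonoid M]
    (ε : Finset α) (g : Finset α → M) :
    ∑ j ∈ εᶜ, ∑ A ∈ Finset.univ.filter (fun A => insert j ε ⊆ A), g A =
      ∑ A ∈ Finset.univ.filter (fun A => ε ⊆ A), (A.card - ε.card) • g A := by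
  rw [Finset.sum_comm' (t' := Finset.univ.filter (fun A => ε ⊆ A)) (s' := fun A => A \ ε)]
  · refine Finset.sum_congr rfl fun A hA => ?_
    rw [Finset.sum_const, Finset.card_sdiff_of_subset (Finset.mem_filter.mp hA).2]
  · intro j A
    simp only [Finset.mem_compl, Finset.mem_filter, Finset.mem_univ, true_and,
      Finset.insert_subset_iff, Finset.mem_sdiff]
    tauto

theorem N_eq_add_sum_compl {m : ℕ} (π : Finset (Fin m) → ℝ) (ε : Finset (Fin m)) :
    N π ε = π ε + ∑ j ∈ εᶜ, ∑ A ∈ Finset.univ.filter (fun A => insert j ε ⊆ A),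
      π A * (Nat.factorial ε.card : ℝ) * (Nat.factorial (A.card - ε.card - 1) : ℝ) /
        (Nat.factorial A.card : ℝ) := by
  have hmem : ε ∈ Finset.univ.filter (fun A => ε ⊆ A) := by simp
  rw [sum_compl_sum_insert_subset, N, ← Finset.add_sum_erase _ _ hmem,
    ← Finset.add_sum_erase _ _ hmem]
  have hfac : (Nat.factorial ε.card : ℝ) ≠ 0 := by positivity
  simp only [Nat.sub_self, zero_smul, zero_add, Nat.factorial_zero, Nat.cast_one, mul_one]
  rw [mul_div_cancel_right₀ _ hfac]
  congr 1
  refine Finset.sum_congr rfl fun A hA => ?_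
  obtain ⟨hne, hA⟩ := Finset.mem_erase.mp hA
  have hlt : ε.card < A.card :=
    Finset.card_lt_card ((Finset.mem_filter.mp hA).2.ssubset_of_ne hne.symm)
  rw [← Nat.mul_factorial_pred (Nat.sub_ne_zero_of_lt hlt), nsmul_eq_mul]
  push_cast
  ring

theorem N_pos {m : ℕ} {π : Finset (Fin m) → ℝ} (hpos : ∀ A, 0 < π A) (ε : Finset (Fin m)) :
    0 < N π ε := by
  refine Finset.sum_pos (fun A _ => ?_) ⟨ε, by simp⟩
  have := hpos A
  positivity

/-- For every subset `ε` of `Fin m`, the sequential policy defines a probability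
distribution over the remaining choices: `π'(† | ε) + Σ_{j ∉ ε} π'(j | ε) = 1`. -/
theorem seqPolicy_sum_eq_one (m : ℕ) (hm : 1 ≤ m) (π : Finset (Fin m) → ℝ)
    (hpos : ∀ A : Finset (Fin m), 0 < π A)
    (hsum : ∑ A : Finset (Fin m), π A = 1) :
    ∀ ε : Finset (Fin m),
      seqPolicy π ε none + ∑ j ∈ εᶜ, seqPolicy π ε (some j) = 1 := by
  intro ε
  simp only [seqPolicy]
  rw [← Finset.mul_sum, one_div_mul_eq_div, ← add_div, ← N_eq_add_sum_compl]
  exact div_self (N_pos hpos ε).ne'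
end

section
/- With N as defined, for every subset ε of {1,…,m} one has the recursion N(ε) = π(ε) + (1/(|ε| + 1)) · Σ_{j ∉ ε} N(ε ∪ {j}). -/
theorem factorial_weight_succ (x : ℝ) (e d : ℕ) :
    x * (e.factorial : ℝ) * ((d + 1).factorial : ℝ) / ((e + (d + 1)).factorial : ℝ) =
      1 / ((e : ℝ) + 1) * (((d + 1 : ℕ) : ℝ) *
        (x * ((e + 1).factorial : ℝ) * (d.factorial : ℝ) / ((e + (d + 1)).factorial : ℝ))) := by
  have he : (e : ℝ) + 1 ≠ 0 := by positivity
  have hf : ((e + (d + 1)).factorial : ℝ) ≠ 0 := by positivity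
  rw [Nat.factorial_succ d, Nat.factorial_succ e]
  push_cast
  field_simp

/-- The contribution of a single superset `A` to the recursion for `N`. -/
theorem summand_recursion {α : Type*} [DecidableEq α] [Fintype α] (x : ℝ) (ε A : Finset α) :
    (if ε ⊆ A then x * (ε.card.factorial : ℝ) * ((A.card - ε.card).factorial : ℝ) /
      (A.card.factorial : ℝ) else 0) =
    (if A = ε then x else 0) + 1 / ((ε.card : ℝ) + 1) * ∑ j ∈ εᶜ,
      if insert j ε ⊆ A then x * ((insert j ε).card.factorial : ℝ) *
        ((A.card - (insert j ε).card).factorial : ℝ) / (A.card.factorial : ℝ) else 0 := by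
  by_cases hA : ε ⊆ A
  · have hsum : (∑ j ∈ εᶜ, if insert j ε ⊆ A then x * ((insert j ε).card.factorial : ℝ) *
        ((A.card - (insert j ε).card).factorial : ℝ) / (A.card.factorial : ℝ) else 0) =
        ((A \ ε).card : ℝ) * (x * ((ε.card + 1).factorial : ℝ) *
          ((A.card - (ε.card + 1)).factorial : ℝ) / (A.card.factorial : ℝ)) := by
      have hfilter : εᶜ.filter (fun j => insert j ε ⊆ A) = A \ ε := by
        ext j
        simp [Finset.insert_subset_iff, hA, and_comm]
      rw [← Finset.sum_filter, hfilter, ← nsmul_eq_mul]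
      refine Finset.sum_eq_card_nsmul fun j hj => ?_
      rw [Finset.card_insert_of_notMem (Finset.mem_sdiff.mp hj).2]
    rw [hsum, if_pos hA]
    rcases eq_or_ne A ε with rfl | hne
    · have hf : (A.card.factorial : ℝ) ≠ 0 := by positivity
      simp [hf]
    · have hlt : ε.card < A.card := Finset.card_lt_card (hA.ssubset_of_ne hne.symm)
      obtain ⟨d, hd⟩ : ∃ d, A.card = ε.card + (d + 1) := ⟨A.card - ε.card - 1, by omega⟩
      rw [if_neg hne, zero_add, Finset.card_sdiff_of_subset hA, hd, Nat.add_sub_cancel_left,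
        show ε.card + (d + 1) - (ε.card + 1) = d by omega]
      exact factorial_weight_succ x ε.card d
  · have hne : A ≠ ε := fun h => hA h.symm.subset
    have hins (j : α) : ¬insert j ε ⊆ A := fun h => hA ((Finset.subset_insert j ε).trans h)
    simp [hA, hne, hins]

/-- Recursion for `N`: for every subset `ε` of `Fin m`,
`N(ε) = π(ε) + (1/(|ε| + 1)) · Σ_{j ∉ ε} N(ε ∪ {j})`. -/
theorem N_recursion (m : ℕ) (hm : 1 ≤ m) (π : Finset (Fin m) → ℝ)
    (hpos : ∀ A : Finset (Fin m), 0 < π A)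
    (hsum : ∑ A : Finset (Fin m), π A = 1) :
    ∀ ε : Finset (Fin m),
      N π ε = π ε + (1 / ((ε.card : ℝ) + 1)) * ∑ j ∈ εᶜ, N π (insert j ε) := by
  intro ε
  simp only [N, Finset.sum_filter]
  rw [Finset.sum_comm, Finset.mul_sum, Finset.sum_congr rfl fun A _ => summand_recursion (π A) ε A,
    Finset.sum_add_distrib]
  simp
end

section
/- With N and the sequential policy π' as defined, for every subset ε ⊆ {1,…,m} of cardinality p and every ordering (j_1, …, j_p) of the elements of ε (i.e., every duplicate-free list whose underlying set is ε), the product of sequential choice probabilities telescopes: π'(j_1 | ∅) · π'(j_2 | {j_1}) · ⋯ · π'(j_p | {j_1,…,j_{p−1}}) · π'(† | ε) = π(ε) / p!. -/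
/-- Given a policy `q` (where `q ε (some j)` is the probability of choosing `j` next
and `q ε none` that of terminating), `seqProd q ε (j₁ :: ⋯ :: jₚ :: [])` is the product
`q(j₁ | ε) · q(j₂ | ε ∪ {j₁}) · ⋯ · q(jₚ | ε ∪ {j₁,…,j_{p−1}}) · q(† | ε ∪ {j₁,…,jₚ})`. -/
noncomputable def seqProd {m : ℕ} (q : Finset (Fin m) → Option (Fin m) → ℝ) :
    Finset (Fin m) → List (Fin m) → ℝ
  | ε, [] => q ε none
  | ε, j :: L => q ε (some j) * seqProd q (insert j ε) L

theorem N_empty {m : ℕ} (π : Finset (Fin m) → ℝ) : N π ∅ = ∑ A, π A := by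
  simp [N, Nat.factorial_ne_zero]

theorem seqPolicy_some {m : ℕ} (π : Finset (Fin m) → ℝ) {ε : Finset (Fin m)} {j : Fin m}
    (hj : j ∉ ε) :
    seqPolicy π ε (some j) = N π (insert j ε) / ((ε.card + 1) * N π ε) := by
  have h : N π (insert j ε) = (ε.card + 1) *
      ∑ A ∈ Finset.univ.filter (fun A => insert j ε ⊆ A),
        π A * (Nat.factorial ε.card : ℝ) * (Nat.factorial (A.card - ε.card - 1) : ℝ) /
          (Nat.factorial A.card : ℝ) := by
    rw [N, Finset.mul_sum]
    refine Finset.sum_congr rfl fun A _ => ?_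
    rw [Finset.card_insert_of_notMem hj, Nat.factorial_succ, Nat.sub_sub]
    push_cast
    ring
  have hc : (ε.card + 1 : ℝ) ≠ 0 := by positivity
  rw [h, mul_div_mul_left _ _ hc, seqPolicy, one_div_mul_eq_div]

theorem seqProd_seqPolicy {m : ℕ} {π : Finset (Fin m) → ℝ} (hpos : ∀ A, 0 < π A)
    (L : List (Fin m)) (hL : L.Nodup) (ε : Finset (Fin m)) (hdisj : ∀ j ∈ L, j ∉ ε) :
    seqProd (seqPolicy π) ε L =
      π (ε ∪ L.toFinset) * (Nat.factorial ε.card : ℝ) /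
        (N π ε * (Nat.factorial (ε.card + L.length) : ℝ)) := by
  induction L generalizing ε with
  | nil =>
    have hf : (Nat.factorial ε.card : ℝ) ≠ 0 := by positivity
    simp [seqProd, seqPolicy, mul_div_mul_right _ _ hf]
  | cons j L ih =>
    obtain ⟨hjL, hL⟩ := List.nodup_cons.mp hL
    have hj : j ∉ ε := hdisj j (by simp)
    have hd : ∀ k ∈ L, k ∉ insert j ε := by
      intro k hk
      rw [Finset.mem_insert, not_or]
      exact ⟨fun h => hjL (h ▸ hk), hdisj k (List.mem_cons_of_mem _ hk)⟩
    have hN := (N_pos hpos ε).ne'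
    have hN' := (N_pos hpos (insert j ε)).ne'
    rw [seqProd, ih hL _ hd, seqPolicy_some π hj, Finset.card_insert_of_notMem hj,
      List.toFinset_cons, Finset.insert_union, Finset.union_insert, List.length_cons,
      Nat.factorial_succ ε.card, show ε.card + 1 + L.length = ε.card + (L.length + 1) by omega]
    push_cast
    field_simp

/-- Telescoping: for every `ε ⊆ Fin m` of cardinality `p` and every ordering
`(j₁, …, jₚ)` of the elements of `ε` (a duplicate-free list with underlying set `ε`),
`π'(j₁ | ∅) · π'(j₂ | {j₁}) · ⋯ · π'(jₚ | {j₁,…,j_{p−1}}) · π'(† | ε) = π(ε) / p!`. -/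
theorem seqProd_eq_pi_div_factorial (m : ℕ) (hm : 1 ≤ m) (π : Finset (Fin m) → ℝ)
    (hpos : ∀ A : Finset (Fin m), 0 < π A)
    (hsum : ∑ A : Finset (Fin m), π A = 1) :
    ∀ ε : Finset (Fin m), ∀ L : List (Fin m), L.Nodup → L.toFinset = ε →
      seqProd (seqPolicy π) ∅ L = π ε / (Nat.factorial ε.card : ℝ) := by
  rintro ε L hL rfl
  rw [seqProd_seqPolicy hpos L hL ∅ (by simp), N_empty, hsum, List.toFinset_card_of_nodup hL]
  simp
end
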